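/- arXiv:1501.00298 — 14 statements merged into one kernel-verified Lean document; each statement's English description precedes it below -/
import Mathlib

section
/- Let r = (r_1,…,r_5) ∈ ℝ⁵ satisfy 0 < r_1 ≤ r_2 ≤ r_3 ≤ r_4 ≤ r_5, let r be generic, and assume the index set {1,5} is short, i.e. r_1 + r_5 < r_2 + r_3 + r_4. Then there exists a real number y₀ with r_5 − r_4 ≤ y₀ ≤ r_4 + r_5 such that for every x with r_2 − r_1 ≤ x ≤ r_1 + r_2 the point (x, y₀) belongs to Δ₅(r); in particular the horizontal slice Δ₅(r) ∩ {(x,y) : y = y₀} is a segment of length 2r_1. -/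
/-- `r` is generic: for every index set `I`, `∑_{i ∈ I} r_i ≠ ∑_{i ∉ I} r_i`. -/
def IsGeneric {n : ℕ} (r : Fin n → ℝ) : Prop :=
  ∀ I : Finset (Fin n), ∑ i ∈ I, r i ≠ ∑ i ∈ Iᶜ, r i

/-- The region `Δ₅(r) ⊆ ℝ²` (for a length vector `r = (r_1,…,r_5)`, zero-indexed). -/
def Delta5 (r : Fin 5 → ℝ) : Set (ℝ × ℝ) :=
  {p | r 1 - r 0 ≤ p.1 ∧ p.1 ≤ r 0 + r 1 ∧
       r 4 - r 3 ≤ p.2 ∧ p.2 ≤ r 3 + r 4 ∧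
       p.1 - r 2 ≤ p.2 ∧ -p.1 + r 2 ≤ p.2 ∧ p.2 ≤ p.1 + r 2}

theorem stmt0 (r : Fin 5 → ℝ) (h0 : 0 < r 0)
    (h01 : r 0 ≤ r 1) (h12 : r 1 ≤ r 2) (h23 : r 2 ≤ r 3) (h34 : r 3 ≤ r 4)
    (hgen : IsGeneric r) (hshort : r 0 + r 4 < r 1 + r 2 + r 3) :
    ∃ y₀ : ℝ, r 4 - r 3 ≤ y₀ ∧ y₀ ≤ r 3 + r 4 ∧
      ∀ x : ℝ, r 1 - r 0 ≤ x → x ≤ r 0 + r 1 → (x, y₀) ∈ Delta5 r := by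
  refine ⟨r 1 - r 0 + r 2, by linarith, by linarith, fun x hx hx' => ?_⟩
  refine ⟨hx, hx', ?_, ?_, ?_, ?_, ?_⟩ <;> dsimp only <;> linarith
end

section
/- Let r = (r_1,…,r_5) ∈ ℝ⁵ satisfy 0 < r_1 ≤ r_2 ≤ r_3 ≤ r_4 ≤ r_5, let r be generic, and assume the index set {1,5} is short, i.e. r_1 + r_5 < r_2 + r_3 + r_4. Then there exists x₀ with r_2 − r_1 ≤ x₀ ≤ r_2 + r_1 such that min(r_5 + r_4, x₀ + r_3) − max(r_5 − r_4, |x₀ − r_3|) ≥ 2r_1; that is, the vertical slice Δ₅(r) ∩ {(x,y) : x = x₀} is a segment of length at least 2r_1. -/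
theorem stmt1 (r : Fin 5 → ℝ) (h0 : 0 < r 0)
    (h01 : r 0 ≤ r 1) (h12 : r 1 ≤ r 2) (h23 : r 2 ≤ r 3) (h34 : r 3 ≤ r 4)
    (hgen : IsGeneric r) (hshort : r 0 + r 4 < r 1 + r 2 + r 3) :
    ∃ x₀ : ℝ, r 1 - r 0 ≤ x₀ ∧ x₀ ≤ r 1 + r 0 ∧
      2 * r 0 ≤ min (r 4 + r 3) (x₀ + r 2) - max (r 4 - r 3) |x₀ - r 2| := by
  refine ⟨max (r 1) (2 * r 0 + r 4 - r 3 - r 2), ?_, ?_, ?_⟩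
  · exact le_trans (by linarith) (le_max_left _ _)
  · exact max_le (by linarith) (by linarith)
  · have hx₁ := le_max_left (r 1) (2 * r 0 + r 4 - r 3 - r 2)
    have hx₂ := le_max_right (r 1) (2 * r 0 + r 4 - r 3 - r 2)
    have hx₃ : max (r 1) (2 * r 0 + r 4 - r 3 - r 2) ≤ r 4 + r 3 + r 2 - 2 * r 0 :=
      max_le (by linarith) (by linarith)
    rw [le_sub_iff_add_le, ← le_sub_iff_add_le']
    refine max_le ?_ (abs_le.mpr ⟨?_, ?_⟩)
    · rw [le_sub_iff_add_le, le_min_iff]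
      constructor <;> linarith
    · rw [neg_le_sub_iff_le_add, ← sub_le_iff_le_add', le_sub_iff_add_le, le_min_iff]
      constructor <;> linarith
    · rw [le_sub_iff_add_le, le_min_iff]
      constructor <;> linarith
end

section
/- Let r = (r_1,…,r_5) ∈ ℝ⁵ satisfy 0 < r_1 ≤ r_2 ≤ r_3 ≤ r_4 ≤ r_5, let r be generic, and assume the index set {1,5} is short, i.e. r_1 + r_5 < r_2 + r_3 + r_4. Then there exist a point (x₀, y₀) ∈ Δ₅(r) and real numbers a_1 ≤ 0 ≤ b_1 and a_2 ≤ 0 ≤ b_2 with b_1 − a_1 = 2r_1 and b_2 − a_2 = 2r_1 such that the horizontal segment {(x₀ + t, y₀) : a_1 ≤ t ≤ b_1} and the vertical segment {(x₀, y₀ + t) : a_2 ≤ t ≤ b_2} are both contained in Δ₅(r); consequently the convex hull of the union of these two segments (a diamond-like region of size 2r_1 centered at (x₀, y₀)) is contained in Δ₅(r). -/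
theorem convex_Delta5 (r : Fin 5 → ℝ) : Convex ℝ (Delta5 r) := by
  rintro ⟨x, y⟩ ⟨h1, h2, h3, h4, h5, h6, h7⟩ ⟨x', y'⟩ ⟨k1, k2, k3, k4, k5, k6, k7⟩ s t hs ht hst
  obtain rfl : t = 1 - s := by linarith
  simp only at *
  simp only [Delta5, Set.mem_ofPred_eq, Prod.smul_mk, Prod.mk_add_mk, smul_eq_mul]
  refine ⟨?_, ?_, ?_, ?_, ?_, ?_, ?_⟩ <;> nlinarith

/-- An abscissa at which the vertical slice of `Δ₅(r)` has length at least `2 r₁`. -/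
theorem exists_abscissa {a b c d e : ℝ} (ha : 0 < a) (hab : a ≤ b) (hbc : b ≤ c) (hcd : c ≤ d)
    (hde : d ≤ e) (hshort : a + e < b + c + d) :
    ∃ x, b - a ≤ x ∧ x ≤ a + b ∧ a ≤ x ∧ 2 * a + e - d - c ≤ x ∧
      x - c + 2 * a ≤ d + e ∧ c - x + 2 * a ≤ d + e := by
  rcases le_total (a + b) c with h | h
  · refine ⟨a + b, ?_, ?_, ?_, ?_, ?_, ?_⟩ <;> linarith
  · rcases le_total c (2 * a + e - d - c) with h' | h'
    · refine ⟨2 * a + e - d - c, ?_, ?_, ?_, ?_, ?_, ?_⟩ <;> linarith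
    · refine ⟨c, ?_, ?_, ?_, ?_, ?_, ?_⟩ <;> linarith

theorem stmt2 (r : Fin 5 → ℝ) (h0 : 0 < r 0)
    (h01 : r 0 ≤ r 1) (h12 : r 1 ≤ r 2) (h23 : r 2 ≤ r 3) (h34 : r 3 ≤ r 4)
    (hgen : IsGeneric r) (hshort : r 0 + r 4 < r 1 + r 2 + r 3) :
    ∃ p ∈ Delta5 r, ∃ a₁ b₁ a₂ b₂ : ℝ,
      a₁ ≤ 0 ∧ 0 ≤ b₁ ∧ b₁ - a₁ = 2 * r 0 ∧
      a₂ ≤ 0 ∧ 0 ≤ b₂ ∧ b₂ - a₂ = 2 * r 0 ∧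
      {q : ℝ × ℝ | ∃ t, a₁ ≤ t ∧ t ≤ b₁ ∧ q = (p.1 + t, p.2)} ⊆ Delta5 r ∧
      {q : ℝ × ℝ | ∃ t, a₂ ≤ t ∧ t ≤ b₂ ∧ q = (p.1, p.2 + t)} ⊆ Delta5 r ∧
      convexHull ℝ ({q : ℝ × ℝ | ∃ t, a₁ ≤ t ∧ t ≤ b₁ ∧ q = (p.1 + t, p.2)} ∪
          {q : ℝ × ℝ | ∃ t, a₂ ≤ t ∧ t ≤ b₂ ∧ q = (p.1, p.2 + t)}) ⊆ Delta5 r := by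
  obtain ⟨x, hx1, hx2, hx3, hx4, hx5, hx6⟩ := exists_abscissa h0 h01 h12 h23 h34 hshort
  -- The horizontal slice at this height has full width.
  set y := r 1 + r 2 - r 0 with hy
  obtain ⟨l, hly, hyl, hl1, hl2, hl3, hl4, hl5⟩ : ∃ l, l ≤ y ∧ y ≤ l + 2 * r 0 ∧ r 4 - r 3 ≤ l ∧
      x - r 2 ≤ l ∧ -x + r 2 ≤ l ∧ l + 2 * r 0 ≤ r 3 + r 4 ∧ l + 2 * r 0 ≤ x + r 2 := by
    refine ⟨max (max (r 4 - r 3) (y - 2 * r 0)) (max (x - r 2) (-x + r 2)), ?_, ?_, ?_, ?_, ?_, ?_,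
      ?_⟩ <;> grind
  have hH : {q : ℝ × ℝ | ∃ t, r 1 - r 0 - x ≤ t ∧ t ≤ r 0 + r 1 - x ∧ q = (x + t, y)} ⊆
      Delta5 r := by
    rintro _ ⟨t, ht1, ht2, rfl⟩
    refine ⟨?_, ?_, ?_, ?_, ?_, ?_, ?_⟩ <;> dsimp only <;> linarith
  have hV : {q : ℝ × ℝ | ∃ t, l - y ≤ t ∧ t ≤ l + 2 * r 0 - y ∧ q = (x, y + t)} ⊆ Delta5 r := by
    rintro _ ⟨t, ht1, ht2, rfl⟩
    refine ⟨?_, ?_, ?_, ?_, ?_, ?_, ?_⟩ <;> dsimp only <;> linarith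
  refine ⟨(x, y), hH ⟨0, by linarith, by linarith, by simp⟩, r 1 - r 0 - x, r 0 + r 1 - x, l - y,
    l + 2 * r 0 - y, by linarith, by linarith, by ring, by linarith, by linarith, by ring, hH, hV,
    convexHull_min (Set.union_subset hH hV) (convex_Delta5 r)⟩
end

section
/- Let r = (r_1,…,r_6) ∈ ℝ⁶ satisfy 0 < r_1 ≤ r_2 ≤ ⋯ ≤ r_6, let r be generic, and assume the index set {1,6} is short, i.e. r_1 + r_6 < r_2 + r_3 + r_4 + r_5. Then there exist real numbers d₂⁰ with r_4 − r_3 ≤ d₂⁰ ≤ r_3 + r_4 and d₃⁰ with r_6 − r_5 ≤ d₃⁰ ≤ r_5 + r_6 such that for every t with r_2 − r_1 ≤ t ≤ r_1 + r_2 the point (t, d₂⁰, d₃⁰) belongs to Δ₆(r); that is, Δ₆(r) contains a segment of length 2r_1 parallel to the first coordinate axis. -/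
/-- The region `Δ₆(r) ⊆ ℝ³` (for a length vector `r = (r_1,…,r_6)`, zero-indexed):
points `(d_1,d_2,d_3)` with `r_2 - r_1 ≤ d_1 ≤ r_2 + r_1`, `r_4 - r_3 ≤ d_2 ≤ r_3 + r_4`,
`r_6 - r_5 ≤ d_3 ≤ r_5 + r_6`, `|d_1 - d_2| ≤ d_3` and `d_3 ≤ d_1 + d_2`. -/
def Delta6 (r : Fin 6 → ℝ) : Set (Fin 3 → ℝ) :=
  {d | r 1 - r 0 ≤ d 0 ∧ d 0 ≤ r 1 + r 0 ∧
       r 3 - r 2 ≤ d 1 ∧ d 1 ≤ r 2 + r 3 ∧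
       r 5 - r 4 ≤ d 2 ∧ d 2 ≤ r 4 + r 5 ∧
       |d 0 - d 1| ≤ d 2 ∧ d 2 ≤ d 0 + d 1}

theorem stmt3 (r : Fin 6 → ℝ) (h0 : 0 < r 0)
    (h01 : r 0 ≤ r 1) (h12 : r 1 ≤ r 2) (h23 : r 2 ≤ r 3) (h34 : r 3 ≤ r 4) (h45 : r 4 ≤ r 5)
    (hgen : IsGeneric r) (hshort : r 0 + r 5 < r 1 + r 2 + r 3 + r 4) :
    ∃ d₂ d₃ : ℝ, r 3 - r 2 ≤ d₂ ∧ d₂ ≤ r 2 + r 3 ∧ r 5 - r 4 ≤ d₃ ∧ d₃ ≤ r 4 + r 5 ∧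
      ∀ t : ℝ, r 1 - r 0 ≤ t → t ≤ r 0 + r 1 → (![t, d₂, d₃] : Fin 3 → ℝ) ∈ Delta6 r := by
  have hle : r 2 + r 3 ≤ max (r 5 - r 4) (r 2 + r 3) := le_max_right _ _
  have hge : r 5 - r 4 ≤ max (r 5 - r 4) (r 2 + r 3) := le_max_left _ _
  have hub : max (r 5 - r 4) (r 2 + r 3) ≤ r 4 + r 5 := max_le (by linarith) (by linarith)
  have hdiff : max (r 5 - r 4) (r 2 + r 3) ≤ r 2 + r 3 + (r 1 - r 0) :=
    max_le (by linarith) (by linarith)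
  refine ⟨r 2 + r 3, max (r 5 - r 4) (r 2 + r 3), by linarith, le_rfl, hge, hub, ?_⟩
  intro t ht₁ ht₂
  change r 1 - r 0 ≤ t ∧ t ≤ r 1 + r 0 ∧ r 3 - r 2 ≤ r 2 + r 3 ∧ r 2 + r 3 ≤ r 2 + r 3 ∧
    r 5 - r 4 ≤ max (r 5 - r 4) (r 2 + r 3) ∧ max (r 5 - r 4) (r 2 + r 3) ≤ r 4 + r 5 ∧
    |t - (r 2 + r 3)| ≤ max (r 5 - r 4) (r 2 + r 3) ∧
    max (r 5 - r 4) (r 2 + r 3) ≤ t + (r 2 + r 3)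
  exact ⟨ht₁, by linarith, by linarith, le_rfl, hge, hub,
    abs_le.mpr ⟨by linarith, by linarith⟩, by linarith⟩
end

section
/- Let r = (r_1,…,r_6) ∈ ℝ⁶ satisfy 0 < r_1 ≤ r_2 ≤ ⋯ ≤ r_6, let r be generic, and assume r_1 + r_6 < r_2 + r_3 + r_4 + r_5. Then there exist real numbers d₁ with r_2 − r_1 ≤ d₁ ≤ r_2 + r_1, d₂⁰ with r_4 − r_3 ≤ d₂⁰ ≤ r_3 + r_4, and d₃⁰ with r_6 − r_5 ≤ d₃⁰ ≤ r_5 + r_6 such that: (i) for every t with r_2 − r_1 ≤ t ≤ r_1 + r_2 the point (t, d₂⁰, d₃⁰) belongs to Δ₆(r); and (ii) both min(r_3 + r_4, d₁ + d₃⁰) − max(r_4 − r_3, |d₁ − d₃⁰|) ≥ 2r_1 and min(r_5 + r_6, d₁ + d₂⁰) − max(r_6 − r_5, |d₁ − d₂⁰|) ≥ 2r_1 hold. -/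
theorem stmt4 (r : Fin 6 → ℝ) (h0 : 0 < r 0)
    (h01 : r 0 ≤ r 1) (h12 : r 1 ≤ r 2) (h23 : r 2 ≤ r 3) (h34 : r 3 ≤ r 4) (h45 : r 4 ≤ r 5)
    (hgen : IsGeneric r) (hshort : r 0 + r 5 < r 1 + r 2 + r 3 + r 4) :
    ∃ d₁ d₂ d₃ : ℝ,
      r 1 - r 0 ≤ d₁ ∧ d₁ ≤ r 1 + r 0 ∧
      r 3 - r 2 ≤ d₂ ∧ d₂ ≤ r 2 + r 3 ∧
      r 5 - r 4 ≤ d₃ ∧ d₃ ≤ r 4 + r 5 ∧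
      (∀ t : ℝ, r 1 - r 0 ≤ t → t ≤ r 0 + r 1 → (![t, d₂, d₃] : Fin 3 → ℝ) ∈ Delta6 r) ∧
      2 * r 0 ≤ min (r 2 + r 3) (d₁ + d₃) - max (r 3 - r 2) |d₁ - d₃| ∧
      2 * r 0 ≤ min (r 4 + r 5) (d₁ + d₂) - max (r 5 - r 4) |d₁ - d₂| := by
  have hz₁ : r 5 - r 4 ≤ max (r 5 - r 4) (r 2 + r 3) := le_max_left _ _
  have hz₂ : r 2 + r 3 ≤ max (r 5 - r 4) (r 2 + r 3) := le_max_right _ _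
  have hz₃ : max (r 5 - r 4) (r 2 + r 3) ≤ r 2 + r 3 + r 1 - r 0 :=
    max_le (by linarith) (by linarith)
  have hz₄ : max (r 5 - r 4) (r 2 + r 3) ≤ r 4 + r 5 :=
    max_le (by linarith) (by linarith)
  generalize max (r 5 - r 4) (r 2 + r 3) = z at hz₁ hz₂ hz₃ hz₄
  refine ⟨r 1 + r 0, r 2 + r 3, z, by linarith, le_rfl, by linarith, le_rfl, hz₁, hz₄,
    fun t ht₁ ht₂ => ?_, ?_, ?_⟩
  · simp only [Delta6, Set.mem_ofPred_eq, Matrix.cons_val]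
    refine ⟨ht₁, by linarith, by linarith, le_rfl, hz₁, hz₄, ?_, by linarith⟩
    rw [abs_le]
    constructor <;> linarith
  · rw [le_sub_comm, max_le_iff, abs_le]
    rcases min_choice (r 2 + r 3) (r 1 + r 0 + z) with h | h <;> rw [h] <;>
      refine ⟨?_, ?_, ?_⟩ <;> linarith
  · rw [le_sub_comm, max_le_iff, abs_le]
    rcases min_choice (r 4 + r 5) (r 1 + r 0 + (r 2 + r 3)) with h | h <;> rw [h] <;>
      refine ⟨?_, ?_, ?_⟩ <;> linarith
end

section
/- Let r = (r_1,…,r_6) ∈ ℝ⁶ satisfy 0 < r_1 ≤ r_2 ≤ ⋯ ≤ r_6, let r be generic, and assume r_1 + r_6 < r_2 + r_3 + r_4 + r_5. Then there exist a point p ∈ Δ₆(r) and, for each j ∈ {1,2,3}, real numbers a_j ≤ 0 ≤ b_j with b_j − a_j ≥ 2r_1, such that for each j the segment {p + t·e_j : a_j ≤ t ≤ b_j} (where e_j is the j-th standard basis vector of ℝ³) is contained in Δ₆(r); consequently the convex hull of the union of these three axis-parallel segments (a diamond-like region of size 2r_1) is contained in Δ₆(r). -/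
theorem convex_delta6 (r : Fin 6 → ℝ) : Convex ℝ (Delta6 r) := by
  have coord (i : Fin 3) : IsLinearMap ℝ fun d : Fin 3 → ℝ => d i :=
    (LinearMap.proj (R := ℝ) (φ := fun _ : Fin 3 => ℝ) i).isLinear
  have sub (i j : Fin 3) : IsLinearMap ℝ fun d : Fin 3 → ℝ => d i - d j :=
    IsLinearMap.mk' _ (coord i) - IsLinearMap.mk' _ (coord j) |>.isLinear
  have h (f : (Fin 3 → ℝ) → ℝ) (hf : IsLinearMap ℝ f) (a b : ℝ) :
      Convex ℝ {d | a ≤ f d ∧ f d ≤ b} :=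
    (convex_halfSpace_ge hf a).inter (convex_halfSpace_le hf b)
  have upper : IsLinearMap ℝ fun d : Fin 3 → ℝ => d 0 - d 1 - d 2 :=
    IsLinearMap.mk' _ (sub 0 1) - IsLinearMap.mk' _ (coord 2) |>.isLinear
  have lower : IsLinearMap ℝ fun d : Fin 3 → ℝ => d 1 - d 0 - d 2 :=
    IsLinearMap.mk' _ (sub 1 0) - IsLinearMap.mk' _ (coord 2) |>.isLinear
  have sum : IsLinearMap ℝ fun d : Fin 3 → ℝ => d 2 - d 0 - d 1 :=
    IsLinearMap.mk' _ (sub 2 0) - IsLinearMap.mk' _ (coord 1) |>.isLinear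
  convert ((h _ (coord 0) (r 1 - r 0) (r 1 + r 0)).inter
    (h _ (coord 1) (r 3 - r 2) (r 2 + r 3))).inter
    ((h _ (coord 2) (r 5 - r 4) (r 4 + r 5)).inter
    ((convex_halfSpace_le upper 0).inter
    ((convex_halfSpace_le lower 0).inter (convex_halfSpace_le sum 0)))) using 1
  ext d
  simp only [Delta6, Set.mem_inter_iff, Set.mem_ofPred_eq, abs_le]
  constructor
  · rintro ⟨_, _, _, _, _, _, ⟨_, _⟩, _⟩
    refine ⟨⟨⟨?_, ?_⟩, ?_, ?_⟩, ⟨?_, ?_⟩, ?_, ?_, ?_⟩ <;> linarith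
  · rintro ⟨⟨⟨_, _⟩, _, _⟩, ⟨_, _⟩, _, _, _⟩
    refine ⟨?_, ?_, ?_, ?_, ?_, ?_, ⟨?_, ?_⟩, ?_⟩ <;> linarith

theorem stmt5 (r : Fin 6 → ℝ) (h0 : 0 < r 0)
    (h01 : r 0 ≤ r 1) (h12 : r 1 ≤ r 2) (h23 : r 2 ≤ r 3) (h34 : r 3 ≤ r 4) (h45 : r 4 ≤ r 5)
    (hgen : IsGeneric r) (hshort : r 0 + r 5 < r 1 + r 2 + r 3 + r 4) :
    ∃ p ∈ Delta6 r, ∃ a b : Fin 3 → ℝ,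
      (∀ j : Fin 3, a j ≤ 0 ∧ 0 ≤ b j ∧ 2 * r 0 ≤ b j - a j ∧
        {q : Fin 3 → ℝ | ∃ t, a j ≤ t ∧ t ≤ b j ∧
            q = p + t • (Pi.single j 1 : Fin 3 → ℝ)} ⊆ Delta6 r) ∧
      convexHull ℝ (⋃ j : Fin 3,
          {q : Fin 3 → ℝ | ∃ t, a j ≤ t ∧ t ≤ b j ∧
            q = p + t • (Pi.single j 1 : Fin 3 → ℝ)}) ⊆ Delta6 r := by
  obtain ⟨z, hz₁, hz₂, hz₃, hz₄⟩ : ∃ z, r 2 + r 3 ≤ z ∧ r 5 - r 4 ≤ z ∧ z ≤ r 4 + r 5 ∧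
      z ≤ r 2 + r 3 + r 1 - r 0 := by
    refine ⟨max (r 2 + r 3) (r 5 - r 4), le_max_left _ _, le_max_right _ _, ?_, ?_⟩ <;>
      apply max_le <;> linarith
  obtain ⟨l, hl₁, hl₂, hl₃, hl₄⟩ : ∃ l, r 5 - r 4 ≤ l ∧ r 2 + r 3 - (r 0 + r 1) ≤ l ∧ l ≤ z ∧
      (l = r 5 - r 4 ∨ l = r 2 + r 3 - (r 0 + r 1)) :=
    ⟨max (r 5 - r 4) (r 2 + r 3 - (r 0 + r 1)), le_max_left _ _, le_max_right _ _,
      max_le hz₂ (by linarith), max_choice _ _⟩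
  obtain ⟨u, hu₁, hu₂, hu₃, hu₄⟩ : ∃ u, u ≤ r 4 + r 5 ∧ u ≤ r 0 + r 1 + (r 2 + r 3) ∧ z ≤ u ∧
      (u = r 4 + r 5 ∨ u = r 0 + r 1 + (r 2 + r 3)) :=
    ⟨min (r 4 + r 5) (r 0 + r 1 + (r 2 + r 3)), min_le_left _ _, min_le_right _ _,
      le_min hz₃ (by linarith), min_choice _ _⟩
  have hlu : 2 * r 0 ≤ u - l := by
    rcases hl₄ with h | h <;> rcases hu₄ with h' | h' <;> linarith
  have hp : ![r 0 + r 1, r 2 + r 3, z] ∈ Delta6 r := by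
    simp only [Delta6, Set.mem_ofPred_eq, abs_le, Matrix.cons_val]
    refine ⟨?_, ?_, ?_, ?_, ?_, ?_, ⟨?_, ?_⟩, ?_⟩ <;> linarith
  have hseg : ∀ j : Fin 3,
      {q : Fin 3 → ℝ | ∃ t, ![-2 * r 0, -2 * r 0, l - z] j ≤ t ∧ t ≤ ![0, 0, u - z] j ∧
        q = ![r 0 + r 1, r 2 + r 3, z] + t • (Pi.single j 1 : Fin 3 → ℝ)} ⊆ Delta6 r := by
    rintro j _ ⟨t, ht₁, ht₂, rfl⟩
    fin_cases j <;>
    · simp at ht₁ ht₂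
      simp only [Delta6, Set.mem_ofPred_eq, abs_le, Pi.add_apply, Pi.smul_apply,
        Pi.single_apply, smul_eq_mul, Matrix.cons_val]
      refine ⟨?_, ?_, ?_, ?_, ?_, ?_, ⟨?_, ?_⟩, ?_⟩ <;> simp <;> linarith
  refine ⟨_, hp, ![-2 * r 0, -2 * r 0, l - z], ![0, 0, u - z], fun j => ?_,
    convexHull_min (Set.iUnion_subset hseg) (convex_delta6 r)⟩
  refine ⟨?_, ?_, ?_, hseg j⟩ <;> fin_cases j <;> simp <;> linarith
end

section
/- Let r = (r_1,…,r_6) ∈ ℝ⁶ satisfy 0 < r_1 ≤ r_2 ≤ ⋯ ≤ r_6, let r be generic, assume the index set {1,6} is long, i.e. r_1 + r_6 > r_2 + r_3 + r_4 + r_5, and assume γ := r_1 + r_2 + r_3 + r_4 + r_5 − r_6 > 0. Then Δ₆(r) is the 3-simplex given by the convex hull of the four points v = (r_1 + r_2, r_3 + r_4, r_6 − r_5), p_1 = (r_1 + r_2 − γ, r_3 + r_4, r_6 − r_5), p_2 = (r_1 + r_2, r_3 + r_4 − γ, r_6 − r_5), and p_3 = (r_1 + r_2, r_3 + r_4, r_6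 − r_5 + γ). -/
/-- The convex hull of a point of `ℝ³` and its translates by `-g`, `-g`, `g` along the three
coordinate axes, described by its four facet inequalities. -/
theorem convexHull_corner_simplex (a b c g : ℝ) (hg : 0 < g) :
    convexHull ℝ ({![a, b, c], ![a - g, b, c], ![a, b - g, c], ![a, b, c + g]} :
        Set (Fin 3 → ℝ)) =
      {d | d 0 ≤ a ∧ d 1 ≤ b ∧ c ≤ d 2 ∧ (a - d 0) + (b - d 1) + (d 2 - c) ≤ g} := by
  apply Set.Subset.antisymm
  · apply convexHull_min
    · rintro d (rfl | rfl | rfl | rfl) <;> simp [hg.le]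
    · rintro x ⟨hx0, hx1, hx2, hx3⟩ y ⟨hy0, hy1, hy2, hy3⟩ s t hs ht hst
      obtain rfl : t = 1 - s := by linarith
      simp only [Set.mem_ofPred_eq, Pi.add_apply, Pi.smul_apply, smul_eq_mul]
      refine ⟨?_, ?_, ?_, ?_⟩ <;> nlinarith
  · rintro d ⟨h0, h1, h2, h3⟩
    set S : Set (Fin 3 → ℝ) := {![a, b, c], ![a - g, b, c], ![a, b - g, c], ![a, b, c + g]}
    let w : Fin 4 → ℝ :=
      ![(g - ((a - d 0) + (b - d 1) + (d 2 - c))) / g, (a - d 0) / g, (b - d 1) / g, (d 2 - c) / g]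
    let p : Fin 4 → Fin 3 → ℝ := ![![a, b, c], ![a - g, b, c], ![a, b - g, c], ![a, b, c + g]]
    have hw : ∀ i ∈ Finset.univ, 0 ≤ w i := by
      intro i _
      fin_cases i <;> exact div_nonneg (by linarith) hg.le
    have hsum : ∑ i, w i = 1 := by
      simp only [w, Fin.sum_univ_four, Matrix.cons_val]
      field_simp
      ring
    have hp : ∀ i ∈ Finset.univ, p i ∈ convexHull ℝ S := by
      intro i _
      apply subset_convexHull
      fin_cases i <;> simp [p, S]
    have hd : ∑ i, w i • p i = d := by
      ext i
      fin_cases i <;>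
        simp only [w, p, Fin.sum_univ_four, Matrix.cons_val, Pi.add_apply, Pi.smul_apply,
          smul_eq_mul, Fin.zero_eta, Fin.mk_one, Fin.reduceFinMk] <;>
        field_simp <;> ring
    rw [← hd]
    exact (convex_convexHull ℝ S).sum_mem hw hsum hp

theorem stmt6 (r : Fin 6 → ℝ) (h0 : 0 < r 0)
    (h01 : r 0 ≤ r 1) (h12 : r 1 ≤ r 2) (h23 : r 2 ≤ r 3) (h34 : r 3 ≤ r 4) (h45 : r 4 ≤ r 5)
    (hgen : IsGeneric r) (hlong : r 1 + r 2 + r 3 + r 4 < r 0 + r 5)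
    (hγ : 0 < r 0 + r 1 + r 2 + r 3 + r 4 - r 5) :
    Delta6 r = convexHull ℝ
      ({![r 0 + r 1, r 2 + r 3, r 5 - r 4],
        ![r 0 + r 1 - (r 0 + r 1 + r 2 + r 3 + r 4 - r 5), r 2 + r 3, r 5 - r 4],
        ![r 0 + r 1, r 2 + r 3 - (r 0 + r 1 + r 2 + r 3 + r 4 - r 5), r 5 - r 4],
        ![r 0 + r 1, r 2 + r 3, r 5 - r 4 + (r 0 + r 1 + r 2 + r 3 + r 4 - r 5)]} :
        Set (Fin 3 → ℝ)) := by
  rw [convexHull_corner_simplex _ _ _ _ hγ]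
  ext d
  simp only [Delta6, Set.mem_ofPred_eq, abs_le]
  constructor
  · rintro ⟨_, _, _, _, _, _, _, _⟩
    refine ⟨?_, ?_, ?_, ?_⟩ <;> linarith
  · rintro ⟨_, _, _, _⟩
    refine ⟨?_, ?_, ?_, ?_, ?_, ?_, ⟨?_, ?_⟩, ?_⟩ <;> linarith
end

section
/- Let n ≥ 4 and let r = (r_1,…,r_n) ∈ ℝⁿ satisfy 0 < r_1 ≤ r_2 ≤ ⋯ ≤ r_n, let r be generic, assume the index set {1,n} is long, i.e. r_1 + r_n > r_2 + ⋯ + r_{n−1}, and assume γ := r_1 + ⋯ + r_{n−1} − r_n > 0. Define the affine map F : ℝ^{n−3} → ℝ^{n−3} by F(x)_i = (r_1 + ⋯ + r_{i+1}) − (x_1 + ⋯ + x_i) for i = 1,…,n−4 and F(x)_{n−3} = x_{n−3} + r_n − r_{n−1}. Then Δ_cat(r) equals the image under F of the closed simplex {x ∈ ℝ^{n−3} : x_k ≥ 0 for all k and x_1 + ⋯ + x_{n−3} ≤ γ}. -/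
/-- The extended sequence of diagonal lengths `d_0, d_1, …, d_{n-2}` (one-indexed in the paper),
with the conventions `d_0 = r_1` and `d_{n-2} = r_n`; here `d : Fin (n-3) → ℝ` stores
`d_1, …, d_{n-3}` (zero-indexed). -/
def diagSeq {n : ℕ} (hn : 4 ≤ n) (r : Fin n → ℝ) (d : Fin (n - 3) → ℝ) : ℕ → ℝ :=
  fun i =>
    if h0 : i = 0 then r ⟨0, by omega⟩
    else if h : i < n - 2 then d ⟨i - 1, by omega⟩
    else r ⟨n - 1, by omega⟩

/-- The caterpillar polytope `Δ_cat(r) ⊆ ℝ^{n-3}`: with `d_0 = r_1`, `d_{n-2} = r_n`, for every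
`i = 0, …, n-3` the triangle inequalities for `(r_{i+2}, d_i, d_{i+1})` hold (one-indexed). -/
def DeltaCat {n : ℕ} (hn : 4 ≤ n) (r : Fin n → ℝ) : Set (Fin (n - 3) → ℝ) :=
  {d | ∀ i : ℕ, ∀ _hi : i ≤ n - 3,
        r ⟨i + 1, by omega⟩ ≤ diagSeq hn r d i + diagSeq hn r d (i + 1) ∧
        diagSeq hn r d i ≤ r ⟨i + 1, by omega⟩ + diagSeq hn r d (i + 1) ∧
        diagSeq hn r d (i + 1) ≤ r ⟨i + 1, by omega⟩ + diagSeq hn r d i}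

/-- The affine map `F : ℝ^{n-3} → ℝ^{n-3}` given (one-indexed) by
`F(x)_i = (r_1 + ⋯ + r_{i+1}) − (x_1 + ⋯ + x_i)` for `i = 1, …, n-4` and
`F(x)_{n-3} = x_{n-3} + r_n − r_{n-1}`. -/
noncomputable def catMap {n : ℕ} (hn : 4 ≤ n) (r : Fin n → ℝ)
    (x : Fin (n - 3) → ℝ) : Fin (n - 3) → ℝ :=
  fun i =>
    if h : i.val + 1 < n - 3 then
      (∑ j : Fin (i.val + 2), r (Fin.castLE (by omega) j)) -
        ∑ j : Fin (i.val + 1), x (Fin.castLE (by omega) j)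
    else x i + r ⟨n - 1, by omega⟩ - r ⟨n - 2, by omega⟩

/-- Extension of a finite family of reals by zero to a sequence. -/
noncomputable def extendByZero {n : ℕ} (f : Fin n → ℝ) (i : ℕ) : ℝ :=
  if h : i < n then f ⟨i, h⟩ else 0

theorem extendByZero_of_lt {n : ℕ} (f : Fin n → ℝ) {i : ℕ} (h : i < n) :
    extendByZero f i = f ⟨i, h⟩ := dif_pos h

theorem sum_castLE_eq_sum_range {n k : ℕ} (f : Fin n → ℝ) (h : k ≤ n) :
    ∑ j : Fin k, f (Fin.castLE h j) = ∑ j ∈ Finset.range k, extendByZero f j := by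
  rw [← Fin.sum_univ_eq_sum_range]
  refine Finset.sum_congr rfl fun j _ => ?_
  rw [extendByZero_of_lt f (j.2.trans_le h)]
  rfl

theorem sum_univ_eq_sum_range_extendByZero {n : ℕ} (f : Fin n → ℝ) :
    ∑ j, f j = ∑ j ∈ Finset.range n, extendByZero f j :=
  sum_castLE_eq_sum_range f le_rfl

/-- If the smallest side `R 0` satisfies `γ ≤ 2 * R 0`, where `γ` is the sum of all sides but the
last minus the last, then the upper triangle inequalities along the caterpillar imply the others. -/
theorem triangle_inequalities_of_upper {N : ℕ} {R D : ℕ → ℝ} (hR0 : 0 < R 0)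
    (hR : ∀ i ≤ N, R 0 ≤ R (i + 1)) (hD0 : D 0 = R 0)
    (hγ : ∑ j ∈ Finset.range (N + 2), R j - D (N + 1) ≤ 2 * R 0)
    (hup : ∀ i ≤ N, D (i + 1) ≤ R (i + 1) + D i) {i : ℕ} (hi : i ≤ N) :
    R (i + 1) ≤ D i + D (i + 1) ∧ D i ≤ R (i + 1) + D (i + 1) := by
  have hlow : ∀ k ≤ N + 1, 0 ≤ ∑ j ∈ Finset.range (k + 1), R j - D k := by
    intro k
    induction k with
    | zero => intro _; simp [hD0]
    | succ k ih =>
      intro hk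
      have h1 := ih (by omega)
      have h2 := hup k (by omega)
      rw [Finset.sum_range_succ]
      linarith
  have hhigh : ∀ k ≤ N + 1, ∑ j ∈ Finset.range (k + 1), R j - D k ≤ 2 * R 0 := by
    intro k hk
    induction hk using Nat.decreasingInduction with
    | self => exact hγ
    | of_succ k hk ih =>
      have h2 := hup k (by omega)
      rw [Finset.sum_range_succ] at ih
      linarith
  have hsum : ∀ k, k + 1 ≤ N + 1 → 2 * R 0 ≤ ∑ j ∈ Finset.range (k + 2), R j := by
    intro k hk
    induction k with
    | zero =>
      have := hR 0 (by omega)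
      simp only [Finset.sum_range_succ, Finset.sum_range_zero]
      simp only [Nat.zero_add] at this ⊢
      linarith
    | succ k ih =>
      have h1 := ih (by omega)
      have h2 := hR (k + 1) (by omega)
      rw [Finset.sum_range_succ]
      linarith
  have hl := hlow i (by omega)
  have hh := hhigh i (by omega)
  have hh' := hhigh (i + 1) (by omega)
  have hRi := hR i hi
  rw [Finset.sum_range_succ _ (i + 1)] at hh'
  refine ⟨?_, by linarith⟩
  rcases i with _ | k
  · simp only [Nat.zero_add, Finset.sum_range_one] at *
    linarith
  · have := hsum k (by omega)
    simp only [Nat.add_assoc, Nat.reduceAdd] at *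
    linarith

theorem diagSeq_zero {n : ℕ} (hn : 4 ≤ n) (r : Fin n → ℝ) (d : Fin (n - 3) → ℝ) :
    diagSeq hn r d 0 = extendByZero r 0 := by
  rw [extendByZero_of_lt r (by omega)]
  simp [diagSeq]

theorem diagSeq_succ {n : ℕ} (hn : 4 ≤ n) (r : Fin n → ℝ) (d : Fin (n - 3) → ℝ) {i : ℕ}
    (hi : i < n - 3) : diagSeq hn r d (i + 1) = d ⟨i, hi⟩ := by
  have h : i + 1 < n - 2 := by omega
  simp [diagSeq, h]

theorem diagSeq_last {m : ℕ} (hn : 4 ≤ m + 4) (r : Fin (m + 4) → ℝ) (d : Fin (m + 4 - 3) → ℝ) :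
    diagSeq hn r d (m + 2) = extendByZero r (m + 3) := by
  rw [extendByZero_of_lt r (by omega)]
  simp [diagSeq]

/-- Under the long-set hypothesis only the upper triangle inequalities matter. -/
theorem mem_DeltaCat_iff {m : ℕ} (hn : 4 ≤ m + 4) (r : Fin (m + 4) → ℝ)
    (h0 : 0 < extendByZero r 0) (hmono : Monotone r)
    (hlong : ∑ j ∈ Finset.range (m + 3), extendByZero r j - extendByZero r (m + 3) ≤
      2 * extendByZero r 0) (d : Fin (m + 4 - 3) → ℝ) :
    d ∈ DeltaCat hn r ↔ ∀ i ≤ m + 1,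
      diagSeq hn r d (i + 1) ≤ extendByZero r (i + 1) + diagSeq hn r d i := by
  constructor
  · intro h i hi
    rw [extendByZero_of_lt r (by omega)]
    exact (h i hi).2.2
  · intro h i hi
    have hi' : i ≤ m + 1 := hi
    have hR : ∀ i ≤ m + 1, extendByZero r 0 ≤ extendByZero r (i + 1) := by
      intro i hi
      rw [extendByZero_of_lt r (by omega), extendByZero_of_lt r (by omega)]
      exact hmono (Fin.mk_le_mk.2 (Nat.zero_le _))
    have key := triangle_inequalities_of_upper h0 hR (diagSeq_zero hn r d)
      (by rw [diagSeq_last]; exact hlong) h hi'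
    have hup := h i hi'
    rw [extendByZero_of_lt r (by omega)] at key hup
    exact ⟨key.1, key.2, hup⟩

theorem catMap_of_lt {m : ℕ} (hn : 4 ≤ m + 4) (r : Fin (m + 4) → ℝ) (x : Fin (m + 4 - 3) → ℝ)
    {k : ℕ} (hk : k < m) : catMap hn r x ⟨k, by omega⟩ =
      ∑ j ∈ Finset.range (k + 2), extendByZero r j -
        ∑ j ∈ Finset.range (k + 1), extendByZero x j := by
  have h : k + 1 < m + 4 - 3 := by omega
  simp only [catMap, h, dif_pos]
  rw [sum_castLE_eq_sum_range, sum_castLE_eq_sum_range]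

theorem catMap_last {m : ℕ} (hn : 4 ≤ m + 4) (r : Fin (m + 4) → ℝ) (x : Fin (m + 4 - 3) → ℝ) :
    catMap hn r x ⟨m, by omega⟩ =
      extendByZero x m + extendByZero r (m + 3) - extendByZero r (m + 2) := by
  have h : ¬ m + 1 < m + 4 - 3 := by omega
  simp only [catMap, h, dif_neg, not_false_eq_true]
  rw [extendByZero_of_lt r (by omega), extendByZero_of_lt r (by omega),
    extendByZero_of_lt x (by omega)]
  rfl

theorem diagSeq_catMap {m : ℕ} (hn : 4 ≤ m + 4) (r : Fin (m + 4) → ℝ) (x : Fin (m + 4 - 3) → ℝ)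
    {k : ℕ} (hk : k ≤ m) : diagSeq hn r (catMap hn r x) k =
      ∑ j ∈ Finset.range (k + 1), extendByZero r j -
        ∑ j ∈ Finset.range k, extendByZero x j := by
  rcases k with _ | k
  · simp [diagSeq_zero]
  · rw [diagSeq_succ hn r _ (by omega), catMap_of_lt hn r x (by omega)]

/-- The simplex inequalities for `x` are the upper triangle inequalities for `catMap hn r x`. -/
theorem upper_catMap_iff {m : ℕ} (hn : 4 ≤ m + 4) (r : Fin (m + 4) → ℝ)
    (x : Fin (m + 4 - 3) → ℝ) :
    (∀ i ≤ m + 1, diagSeq hn r (catMap hn r x) (i + 1) ≤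
      extendByZero r (i + 1) + diagSeq hn r (catMap hn r x) i) ↔
    (∀ k, 0 ≤ x k) ∧ ∑ k, x k ≤ (∑ i, r i) - 2 * r ⟨m + 4 - 1, by omega⟩ := by
  have hlast : diagSeq hn r (catMap hn r x) (m + 1) =
      extendByZero x m + extendByZero r (m + 3) - extendByZero r (m + 2) := by
    rw [diagSeq_succ hn r _ (by omega), catMap_last]
  have hstep : ∀ i < m, (diagSeq hn r (catMap hn r x) (i + 1) ≤
      extendByZero r (i + 1) + diagSeq hn r (catMap hn r x) i ↔ 0 ≤ extendByZero x i) := by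
    intro i hi
    rw [diagSeq_catMap hn r x (Nat.add_one_le_of_lt hi), diagSeq_catMap hn r x hi.le,
      Finset.sum_range_succ _ (i + 1),
      Finset.sum_range_succ (extendByZero x) i]
    constructor <;> intro h <;> linarith
  have hm : diagSeq hn r (catMap hn r x) (m + 1) ≤
      extendByZero r (m + 1) + diagSeq hn r (catMap hn r x) m ↔
      ∑ k, x k ≤ (∑ i, r i) - 2 * r ⟨m + 4 - 1, by omega⟩ := by
    rw [hlast, diagSeq_catMap hn r x le_rfl, sum_univ_eq_sum_range_extendByZero x,
      sum_univ_eq_sum_range_extendByZero r, ← extendByZero_of_lt r]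
    simp only [show m + 4 - 3 = m + 1 from rfl, show m + 4 - 1 = m + 3 from rfl]
    rw [Finset.sum_range_succ _ (m + 3), Finset.sum_range_succ _ (m + 2),
      Finset.sum_range_succ _ (m + 1), Finset.sum_range_succ (extendByZero x) m]
    constructor <;> intro h <;> linarith
  have hm1 : diagSeq hn r (catMap hn r x) (m + 1 + 1) ≤
      extendByZero r (m + 1 + 1) + diagSeq hn r (catMap hn r x) (m + 1) ↔
      0 ≤ extendByZero x m := by
    rw [hlast, diagSeq_last]
    constructor <;> intro h <;> linarith
  constructor
  · intro h
    refine ⟨fun ⟨k, hk⟩ => ?_, hm.1 (h m (by omega))⟩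
    rw [← extendByZero_of_lt x hk]
    rcases Nat.lt_or_ge k m with hkm | hkm
    · exact (hstep k hkm).1 (h k (by omega))
    · obtain rfl : k = m := by omega
      exact hm1.1 (h (k + 1) le_rfl)
  · rintro ⟨hx, hs⟩ i hi
    have hx' : ∀ k ≤ m, 0 ≤ extendByZero x k := fun k hk => by
      rw [extendByZero_of_lt x (by omega)]
      exact hx _
    rcases Nat.lt_trichotomy i m with h | rfl | h
    · exact (hstep i h).2 (hx' i h.le)
    · exact hm.2 hs
    · obtain rfl : i = m + 1 := by omega
      exact hm1.2 (hx' m le_rfl)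

theorem catMap_surjective {m : ℕ} (hn : 4 ≤ m + 4) (r : Fin (m + 4) → ℝ) :
    Function.Surjective (catMap hn r) := by
  intro d
  let E : ℕ → ℝ := fun k => ∑ j ∈ Finset.range (k + 1), extendByZero r j - diagSeq hn r d k
  let x : Fin (m + 4 - 3) → ℝ := fun k =>
    if k.val < m then E (k + 1) - E k
    else d k - extendByZero r (m + 3) + extendByZero r (m + 2)
  refine ⟨x, funext fun ⟨k, hk⟩ => ?_⟩
  rcases Nat.lt_or_ge k m with hkm | hkm
  · have hsum : ∑ j ∈ Finset.range (k + 1), extendByZero x j = E (k + 1) - E 0 := by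
      rw [← Finset.sum_range_sub]
      refine Finset.sum_congr rfl fun j hj => ?_
      have hj' := Finset.mem_range.1 hj
      rw [extendByZero_of_lt x (by omega)]
      exact if_pos (by change j < m; omega)
    rw [catMap_of_lt hn r x hkm, hsum]
    simp [E, diagSeq_zero, diagSeq_succ hn r d hk]
  · obtain rfl : k = m := by omega
    rw [catMap_last, extendByZero_of_lt x hk]
    simp only [x, lt_irrefl, if_false]
    ring

theorem stmt7 (n : ℕ) (hn : 4 ≤ n) (r : Fin n → ℝ) (h0 : 0 < r ⟨0, by omega⟩)
    (hmono : Monotone r) (hgen : IsGeneric r)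
    (hlong : (∑ i, r i) - r ⟨0, by omega⟩ - r ⟨n - 1, by omega⟩ <
      r ⟨0, by omega⟩ + r ⟨n - 1, by omega⟩)
    (hγ : 0 < (∑ i, r i) - 2 * r ⟨n - 1, by omega⟩) :
    DeltaCat hn r = catMap hn r ''
      {x : Fin (n - 3) → ℝ | (∀ k, 0 ≤ x k) ∧
        ∑ k, x k ≤ (∑ i, r i) - 2 * r ⟨n - 1, by omega⟩} := by
  obtain ⟨m, rfl⟩ : ∃ m, n = m + 4 := ⟨n - 4, by omega⟩
  rw [← extendByZero_of_lt r] at h0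
  have hlong' : ∑ j ∈ Finset.range (m + 3), extendByZero r j - extendByZero r (m + 3) ≤
      2 * extendByZero r 0 := by
    rw [← extendByZero_of_lt r, ← extendByZero_of_lt r, sum_univ_eq_sum_range_extendByZero,
      Finset.sum_range_succ] at hlong
    simp only [show m + 4 - 1 = m + 3 from rfl] at hlong
    linarith
  have hmem := mem_DeltaCat_iff hn r h0 hmono hlong'
  ext d
  constructor
  · intro hd
    obtain ⟨x, rfl⟩ := catMap_surjective hn r d
    exact ⟨x, (upper_catMap_iff hn r x).1 ((hmem _).1 hd), rfl⟩
  · rintro ⟨x, hx, rfl⟩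
    exact (hmem _).2 ((upper_catMap_iff hn r x).2 hx)
end

section
/- Let r = (r_1,…,r_6) ∈ ℝ⁶ satisfy 0 < r_1 ≤ r_2 ≤ ⋯ ≤ r_6, let r be generic, and assume {1,6} is short (r_1 + r_6 < r_2 + r_3 + r_4 + r_5), {4,6} is long (r_4 + r_6 > r_1 + r_2 + r_3 + r_5), and {1,2,6} is long (r_1 + r_2 + r_6 > r_3 + r_4 + r_5). Consider the rearranged vector s = (r_1, r_4, r_2, r_5, r_3, r_6) and the cuboid C = [r_4 − r_1, r_4 + r_1] × [r_5 − r_2, r_5 + r_2] × [r_6 − r_3, r_6 + r_3] ⊆ ℝ³. Then: (a) every (d_1, d_2, d_3) ∈ C satisfies d_1 ≤ d_2 + d_3 and d_2 ≤ d_1 + d_3, so that Δ₆(s) = C ∩ {(d_1,d_2,d_3) : d_3 ≤ d_1 + d_2}; (b) the four vertices (r_4 − r_1, r_5 − r_2, r_6 − r_3), (r_4 − r_1, r_5 − r_2, r_6 + r_3), (r_4 + r_1, r_5 − r_2, r_6 + r_3) and (r_4 − r_1, r_5 + r_2, r_6 + r_3) of C satisfy d_3 > d_1 + d_2 (so they do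 not lie in Δ₆(s)), while the vertex (r_4 − r_1, r_5 + r_2, r_6 − r_3) satisfies d_3 < d_1 + d_2. -/
/-- The cuboid `[s_2-s_1, s_2+s_1] × [s_4-s_3, s_4+s_3] × [s_6-s_5, s_6+s_5]` (one-indexed)
associated to a length vector `s`. -/
def Cuboid6 (s : Fin 6 → ℝ) : Set (Fin 3 → ℝ) :=
  {d | s 1 - s 0 ≤ d 0 ∧ d 0 ≤ s 1 + s 0 ∧
       s 3 - s 2 ≤ d 1 ∧ d 1 ≤ s 3 + s 2 ∧
       s 5 - s 4 ≤ d 2 ∧ d 2 ≤ s 5 + s 4}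

theorem stmt8 (r : Fin 6 → ℝ) (h0 : 0 < r 0)
    (h01 : r 0 ≤ r 1) (h12 : r 1 ≤ r 2) (h23 : r 2 ≤ r 3) (h34 : r 3 ≤ r 4) (h45 : r 4 ≤ r 5)
    (hgen : IsGeneric r)
    (h16short : r 0 + r 5 < r 1 + r 2 + r 3 + r 4)
    (h46long : r 0 + r 1 + r 2 + r 4 < r 3 + r 5)
    (h126long : r 2 + r 3 + r 4 < r 0 + r 1 + r 5) :
    -- (a)
    ((∀ d ∈ Cuboid6 ![r 0, r 3, r 1, r 4, r 2, r 5],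
        d 0 ≤ d 1 + d 2 ∧ d 1 ≤ d 0 + d 2) ∧
      Delta6 ![r 0, r 3, r 1, r 4, r 2, r 5] =
        Cuboid6 ![r 0, r 3, r 1, r 4, r 2, r 5] ∩ {d | d 2 ≤ d 0 + d 1}) ∧
    -- (b): four vertices with `d_3 > d_1 + d_2`, hence not in `Δ₆(s)`
    (((r 3 - r 0) + (r 4 - r 1) < r 5 - r 2 ∧
        (![r 3 - r 0, r 4 - r 1, r 5 - r 2] : Fin 3 → ℝ) ∉ Delta6 ![r 0, r 3, r 1, r 4, r 2, r 5]) ∧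
      ((r 3 - r 0) + (r 4 - r 1) < r 5 + r 2 ∧
        (![r 3 - r 0, r 4 - r 1, r 5 + r 2] : Fin 3 → ℝ) ∉ Delta6 ![r 0, r 3, r 1, r 4, r 2, r 5]) ∧
      ((r 3 + r 0) + (r 4 - r 1) < r 5 + r 2 ∧
        (![r 3 + r 0, r 4 - r 1, r 5 + r 2] : Fin 3 → ℝ) ∉ Delta6 ![r 0, r 3, r 1, r 4, r 2, r 5]) ∧
      ((r 3 - r 0) + (r 4 + r 1) < r 5 + r 2 ∧
        (![r 3 - r 0, r 4 + r 1, r 5 + r 2] : Fin 3 → ℝ) ∉ Delta6 ![r 0, r 3, r 1, r 4, r 2, r 5]) ∧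
      -- the vertex `(r_4 - r_1, r_5 + r_2, r_6 - r_3)` satisfies `d_3 < d_1 + d_2`
      r 5 - r 2 < (r 3 - r 0) + (r 4 + r 1)) := by
  have not_mem_Delta6 : ∀ {s : Fin 6 → ℝ} {a b c : ℝ},
      a + b < c → (![a, b, c] : Fin 3 → ℝ) ∉ Delta6 s := by
    rintro s a b c h ⟨-, -, -, -, -, -, -, hd⟩
    exact absurd hd (not_le.mpr h)
  have triangle : ∀ d ∈ Cuboid6 ![r 0, r 3, r 1, r 4, r 2, r 5],
      d 0 ≤ d 1 + d 2 ∧ d 1 ≤ d 0 + d 2 := by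
    rintro d ⟨h1, h2, h3, h4, h5, h6⟩
    simp only [Matrix.cons_val] at h1 h2 h3 h4 h5 h6
    constructor <;> linarith
  have v₁ : (r 3 - r 0) + (r 4 - r 1) < r 5 - r 2 := by linarith
  have v₂ : (r 3 - r 0) + (r 4 - r 1) < r 5 + r 2 := by linarith
  have v₃ : (r 3 + r 0) + (r 4 - r 1) < r 5 + r 2 := by linarith
  have v₄ : (r 3 - r 0) + (r 4 + r 1) < r 5 + r 2 := by linarith
  refine ⟨⟨triangle, ?_⟩, ⟨v₁, not_mem_Delta6 v₁⟩, ⟨v₂, not_mem_Delta6 v₂⟩,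
    ⟨v₃, not_mem_Delta6 v₃⟩, ⟨v₄, not_mem_Delta6 v₄⟩, by linarith⟩
  ext d
  constructor
  · rintro ⟨h1, h2, h3, h4, h5, h6, -, h8⟩
    exact ⟨⟨h1, h2, h3, h4.trans_eq (add_comm _ _), h5, h6.trans_eq (add_comm _ _)⟩, h8⟩
  · rintro ⟨hd, h8⟩
    obtain ⟨h0', h1'⟩ := triangle d hd
    obtain ⟨h1, h2, h3, h4, h5, h6⟩ := hd
    exact ⟨h1, h2, h3, h4.trans_eq (add_comm _ _), h5, h6.trans_eq (add_comm _ _),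
      abs_sub_le_iff.mpr ⟨by linarith, by linarith⟩, h8⟩
end

section
/- Let r = (r_1,…,r_6) ∈ ℝ⁶ satisfy 0 < r_1 ≤ r_2 ≤ ⋯ ≤ r_6, let r be generic, and assume {5,6} is short (r_5 + r_6 < r_1 + r_2 + r_3 + r_4) and {2,3,6} is short (r_2 + r_3 + r_6 < r_1 + r_4 + r_5). Consider the rearranged vector s = (r_1, r_4, r_2, r_5, r_3, r_6) and the cuboid C = [r_4 − r_1, r_4 + r_1] × [r_5 − r_2, r_5 + r_2] × [r_6 − r_3, r_6 + r_3] ⊆ ℝ³. Then exactly three of the eight vertices of C fail to lie in Δ₆(s), namely: (r_4 + r_1, r_5 − r_2, r_6 − r_3), which violates d_1 ≤ d_2 + d_3; (r_4 − r_1, r_5 + r_2, r_6 − r_3), which violates d_2 ≤ d_1 + d_3; and (r_4 − r_1, r_5 − r_2, r_6 + r_3), which violates d_3 ≤ d_1 + d_2; the remaining five vertices of C lie in Δ₆(s). -/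
theorem stmt9 (r : Fin 6 → ℝ) (h0 : 0 < r 0)
    (h01 : r 0 ≤ r 1) (h12 : r 1 ≤ r 2) (h23 : r 2 ≤ r 3) (h34 : r 3 ≤ r 4) (h45 : r 4 ≤ r 5)
    (hgen : IsGeneric r)
    (h56short : r 4 + r 5 < r 0 + r 1 + r 2 + r 3)
    (h236short : r 1 + r 2 + r 5 < r 0 + r 3 + r 4) :
    -- the three vertices of the cuboid that fail to lie in `Δ₆(s)`, `s = (r_1,r_4,r_2,r_5,r_3,r_6)`
    (((r 4 - r 1) + (r 5 - r 2) < r 3 + r 0 ∧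
        (![r 3 + r 0, r 4 - r 1, r 5 - r 2] : Fin 3 → ℝ) ∉ Delta6 ![r 0, r 3, r 1, r 4, r 2, r 5]) ∧
      ((r 3 - r 0) + (r 5 - r 2) < r 4 + r 1 ∧
        (![r 3 - r 0, r 4 + r 1, r 5 - r 2] : Fin 3 → ℝ) ∉ Delta6 ![r 0, r 3, r 1, r 4, r 2, r 5]) ∧
      ((r 3 - r 0) + (r 4 - r 1) < r 5 + r 2 ∧
        (![r 3 - r 0, r 4 - r 1, r 5 + r 2] : Fin 3 → ℝ) ∉ Delta6 ![r 0, r 3, r 1, r 4, r 2, r 5])) ∧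
    -- the remaining five vertices of the cuboid lie in `Δ₆(s)`
    ((![r 3 - r 0, r 4 - r 1, r 5 - r 2] : Fin 3 → ℝ) ∈ Delta6 ![r 0, r 3, r 1, r 4, r 2, r 5] ∧
      (![r 3 + r 0, r 4 + r 1, r 5 - r 2] : Fin 3 → ℝ) ∈ Delta6 ![r 0, r 3, r 1, r 4, r 2, r 5] ∧
      (![r 3 + r 0, r 4 - r 1, r 5 + r 2] : Fin 3 → ℝ) ∈ Delta6 ![r 0, r 3, r 1, r 4, r 2, r 5] ∧
      (![r 3 - r 0, r 4 + r 1, r 5 + r 2] : Fin 3 → ℝ) ∈ Delta6 ![r 0, r 3, r 1, r 4, r 2, r 5] ∧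
      (![r 3 + r 0, r 4 + r 1, r 5 + r 2] : Fin 3 → ℝ) ∈ Delta6 ![r 0, r 3, r 1, r 4, r 2, r 5]) := by
  simp only [Delta6, Set.mem_ofPred_eq, abs_le, Matrix.cons_val]
  refine ⟨⟨⟨by linarith, ?_⟩, ⟨by linarith, ?_⟩, ⟨by linarith, ?_⟩⟩, ?_, ?_, ?_, ?_, ?_⟩
  · rintro ⟨-, -, -, -, -, -, ⟨-, h⟩, -⟩
    linarith
  · rintro ⟨-, -, -, -, -, -, ⟨h, -⟩, -⟩
    linarith
  · rintro ⟨-, -, -, -, -, -, -, h⟩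
    linarith
  all_goals
    refine ⟨?_, ?_, ?_, ?_, ?_, ?_, ⟨?_, ?_⟩, ?_⟩ <;> linarith
end

section
/- Let r = (r_1,…,r_6) ∈ ℝ⁶ satisfy 0 < r_1 ≤ r_2 ≤ ⋯ ≤ r_6, let r be generic, and assume {1,2,6} is short (r_1 + r_2 + r_6 < r_3 + r_4 + r_5) and {1,2,3,4} is short (r_1 + r_2 + r_3 + r_4 < r_5 + r_6). Consider the rearranged vector s = (r_1, r_6, r_2, r_5, r_3, r_4). Then the entire top facet of the associated cuboid lies in Δ₆(s): for every d_1 with r_6 − r_1 ≤ d_1 ≤ r_6 + r_1 and every d_2 with r_5 − r_2 ≤ d_2 ≤ r_5 + r_2, the point (d_1, d_2, r_3 + r_4) belongs to Δ₆(s). -/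
theorem stmt10 (r : Fin 6 → ℝ) (h0 : 0 < r 0)
    (h01 : r 0 ≤ r 1) (h12 : r 1 ≤ r 2) (h23 : r 2 ≤ r 3) (h34 : r 3 ≤ r 4) (h45 : r 4 ≤ r 5)
    (hgen : IsGeneric r)
    (h126short : r 0 + r 1 + r 5 < r 2 + r 3 + r 4)
    (h1234short : r 0 + r 1 + r 2 + r 3 < r 4 + r 5) :
    ∀ d₁ d₂ : ℝ, r 5 - r 0 ≤ d₁ → d₁ ≤ r 5 + r 0 → r 4 - r 1 ≤ d₂ → d₂ ≤ r 4 + r 1 →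
      (![d₁, d₂, r 2 + r 3] : Fin 3 → ℝ) ∈ Delta6 ![r 0, r 5, r 1, r 4, r 2, r 3] := by
  intro d₁ d₂ hd₁ hd₁' hd₂ hd₂'
  change r 5 - r 0 ≤ d₁ ∧ d₁ ≤ r 5 + r 0 ∧ r 4 - r 1 ≤ d₂ ∧ d₂ ≤ r 1 + r 4 ∧
    r 3 - r 2 ≤ r 2 + r 3 ∧ r 2 + r 3 ≤ r 2 + r 3 ∧
    |d₁ - d₂| ≤ r 2 + r 3 ∧ r 2 + r 3 ≤ d₁ + d₂
  rw [abs_le]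
  refine ⟨?_, ?_, ?_, ?_, ?_, ?_, ⟨?_, ?_⟩, ?_⟩ <;> linarith
end

section
/- Let r = (r_1,…,r_6) have positive real entries with r_1 ≤ r_2, r_3 ≤ r_4 and r_5 ≤ r_6. Consider the map which assigns to each closed 6-gon (e_1,…,e_6) with side lengths r the triple of diagonal lengths (‖e_1 + e_2‖, ‖e_3 + e_4‖, ‖e_5 + e_6‖) ∈ ℝ³. Then the image of this map, over all closed 6-gons with side lengths r, is exactly the set Δ₆(r). -/
/-- In a real normed space of dimension at least two, a vector splits as a sum of two vectors of
prescribed norms as soon as the triangle inequalities allow it. -/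
theorem exists_norm_eq_norm_eq_add_eq {E : Type*} [NormedAddCommGroup E] [NormedSpace ℝ E]
    (hE : 1 < Module.rank ℝ E) (v : E) {a b : ℝ} (ha : 0 ≤ a)
    (hsub : |‖v‖ - a| ≤ b) (hadd : b ≤ ‖v‖ + a) :
    ∃ x y : E, ‖x‖ = a ∧ ‖y‖ = b ∧ x + y = v := by
  have : Nontrivial E := (rank_pos_iff_nontrivial (R := ℝ)).mp (zero_lt_one.trans hE)
  obtain ⟨w, hw, hv⟩ : ∃ w : E, ‖w‖ = 1 ∧ v = ‖v‖ • w := by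
    rcases eq_or_ne v 0 with rfl | hv
    · obtain ⟨w, hw⟩ := exists_norm_eq E zero_le_one
      exact ⟨w, hw, by simp⟩
    · refine ⟨‖v‖⁻¹ • v, ?_, ?_⟩
      · rw [norm_smul, norm_inv, norm_norm, inv_mul_cancel₀ (norm_ne_zero_iff.mpr hv)]
      · rw [smul_inv_smul₀ (norm_ne_zero_iff.mpr hv)]
  have hnear : ‖v - a • w‖ = |‖v‖ - a| := by
    conv_lhs => rw [hv]
    rw [← sub_smul, norm_smul, hw, mul_one, Real.norm_eq_abs]
  have hfar : ‖v - (-a) • w‖ = ‖v‖ + a := by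
    conv_lhs => rw [hv]
    rw [← sub_smul, norm_smul, hw, mul_one, Real.norm_eq_abs, sub_neg_eq_add,
      abs_of_nonneg (by positivity)]
  have hmem : ∀ c : ℝ, |c| = a → c • w ∈ Metric.sphere (0 : E) a := fun c hc => by
    rw [mem_sphere_zero_iff_norm, norm_smul, hw, mul_one, Real.norm_eq_abs, hc]
  obtain ⟨x, hx, hxb⟩ := (isPreconnected_sphere hE (0 : E) a).intermediate_value
    (hmem a (abs_of_nonneg ha)) (hmem (-a) (by rw [abs_neg, abs_of_nonneg ha]))
    (f := fun x => ‖v - x‖) (by fun_prop) ⟨hnear.trans_le hsub, hadd.trans_eq hfar.symm⟩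
  exact ⟨x, v - x, mem_sphere_zero_iff_norm.mp hx, hxb, add_sub_cancel x v⟩

theorem stmt13 (r : Fin 6 → ℝ) (hr : ∀ i, 0 < r i)
    (h01 : r 0 ≤ r 1) (h23 : r 2 ≤ r 3) (h45 : r 4 ≤ r 5) :
    (fun e : Fin 6 → EuclideanSpace ℝ (Fin 3) =>
        (![‖e 0 + e 1‖, ‖e 2 + e 3‖, ‖e 4 + e 5‖] : Fin 3 → ℝ)) ''
      {e : Fin 6 → EuclideanSpace ℝ (Fin 3) | (∀ i, ‖e i‖ = r i) ∧ ∑ i, e i = 0} =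
    Delta6 r := by
  have hrank : 1 < Module.rank ℝ (EuclideanSpace ℝ (Fin 3)) := by
    rw [← Module.finrank_eq_rank, finrank_euclideanSpace_fin]
    norm_num
  ext d
  constructor
  · rintro ⟨e, ⟨he, hsum⟩, rfl⟩
    have hlower : ∀ i j, r j - r i ≤ ‖e i + e j‖ := fun i j => by
      rw [← he i, ← he j, add_comm, ← norm_neg (e i)]
      simpa using norm_sub_norm_le (e j) (-e i)
    have hupper : ∀ i j, ‖e i + e j‖ ≤ r i + r j := fun i j => by
      rw [← he i, ← he j]
      exact norm_add_le _ _
    have hclosed : ‖e 4 + e 5‖ = ‖(e 0 + e 1) + (e 2 + e 3)‖ := by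
      rw [← norm_neg (e 4 + e 5)]
      congr 1
      rw [Fin.sum_univ_six] at hsum
      rw [neg_eq_iff_add_eq_zero, ← hsum]
      abel
    have htriangle : |‖e 0 + e 1‖ - ‖e 2 + e 3‖| ≤ ‖e 4 + e 5‖ := by
      rw [hclosed]
      have h := abs_norm_sub_norm_le (e 0 + e 1) (-(e 2 + e 3))
      rwa [norm_neg, sub_neg_eq_add] at h
    exact ⟨hlower 0 1, (hupper 0 1).trans_eq (add_comm _ _), hlower 2 3, hupper 2 3,
      hlower 4 5, hupper 4 5, htriangle, hclosed.trans_le (norm_add_le _ _)⟩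
  · rintro ⟨h1, h2, h3, h4, h5, h6, h7, h8⟩
    have hd0 : 0 ≤ d 0 := (sub_nonneg.mpr h01).trans h1
    have hd2 : 0 ≤ d 2 := (sub_nonneg.mpr h45).trans h5
    obtain ⟨h9, h10⟩ := abs_le.mp h7
    obtain ⟨v, hv⟩ := exists_norm_eq (EuclideanSpace ℝ (Fin 3)) hd2
    obtain ⟨x, y, hx, hy, hxy⟩ := exists_norm_eq_norm_eq_add_eq hrank v (b := d 1) hd0
      (by rw [hv, abs_le]; constructor <;> linarith) (by linarith)
    obtain ⟨e0, e1, he0, he1, hx'⟩ := exists_norm_eq_norm_eq_add_eq hrank x (b := r 1) (hr 0).le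
      (by rw [hx, abs_le]; constructor <;> linarith) (by linarith)
    obtain ⟨e2, e3, he2, he3, hy'⟩ := exists_norm_eq_norm_eq_add_eq hrank y (b := r 3) (hr 2).le
      (by rw [hy, abs_le]; constructor <;> linarith) (by linarith)
    obtain ⟨e4, e5, he4, he5, hv'⟩ := exists_norm_eq_norm_eq_add_eq hrank (-v) (b := r 5)
      (hr 4).le (by rw [norm_neg, hv, abs_le]; constructor <;> linarith)
      (by rw [norm_neg]; linarith)
    refine ⟨![e0, e1, e2, e3, e4, e5], ⟨?_, ?_⟩, ?_⟩
    · intro i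
      fin_cases i <;> assumption
    · have : (e0 + e1) + (e2 + e3) + (e4 + e5) = 0 := by
        rw [hx', hy', hv', hxy, add_neg_cancel]
      rw [Fin.sum_univ_six, ← this]
      change e0 + e1 + e2 + e3 + e4 + e5 = _
      abel
    · change ![‖e0 + e1‖, ‖e2 + e3‖, ‖e4 + e5‖] = d
      rw [hx', hy', hv', norm_neg, hx, hy, hv]
      ext i
      fin_cases i <;> rfl
end

section
/- Let r = (r_1,…,r_5) have positive real entries with r_1 ≤ r_2 and r_4 ≤ r_5. Consider the map which assigns to each closed 5-gon (e_1,…,e_5) with side lengths r the pair of diagonal lengths (‖e_1 + e_2‖, ‖e_4 + e_5‖) ∈ ℝ². Then the image of this map, over all closed 5-gons with side lengths r, is exactly the set Δ₅(r), i.e. the intersection of the rectangle [r_2 − r_1, r_1 + r_2] × [r_5 − r_4, r_4 + r_5] with the region {(x,y) : y ≥ x − r_3, y ≥ −x + r_3, y ≤ x + r_3}. -/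
/-- In a real normed space of dimension greater than one, a vector whose norm satisfies the triangle
inequalities with `a` and `b` is a sum of vectors of norms `a` and `b`. -/
theorem exists_add_eq_of_norm_eq_of_norm_eq {E : Type*} [NormedAddCommGroup E] [NormedSpace ℝ E]
    (hE : 1 < Module.rank ℝ E) {v : E} {a b : ℝ} (ha : 0 ≤ a)
    (hva : ‖v‖ ≤ a + b) (hab : a ≤ ‖v‖ + b) (hba : b ≤ ‖v‖ + a) :
    ∃ u w : E, ‖u‖ = a ∧ ‖w‖ = b ∧ u + w = v := by
  have : Nontrivial E := (rank_pos_iff_nontrivial (R := ℝ)).1 (zero_lt_one.trans hE)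
  obtain ⟨p, hp, hv⟩ : ∃ p : E, ‖p‖ = 1 ∧ v = ‖v‖ • p := by
    rcases eq_or_ne v 0 with rfl | hv
    · obtain ⟨p, hp⟩ := exists_norm_eq E zero_le_one
      exact ⟨p, hp, by simp⟩
    · have : ‖v‖ ≠ 0 := norm_ne_zero_iff.2 hv
      exact ⟨‖v‖⁻¹ • v, by simp [norm_smul, this], by rw [smul_inv_smul₀ this]⟩
  have hnear : ‖v - a • p‖ ≤ b := by
    have : v - a • p = (‖v‖ - a) • p := by rw [sub_smul, ← hv]
    rw [this, norm_smul, hp, mul_one, Real.norm_eq_abs, abs_le]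
    constructor <;> linarith
  have hfar : b ≤ ‖v - (-a) • p‖ := by
    have : v - (-a) • p = (‖v‖ + a) • p := by rw [add_smul, ← hv, neg_smul, sub_neg_eq_add]
    rw [this, norm_smul, hp, mul_one, Real.norm_eq_abs]
    exact hba.trans (le_abs_self _)
  obtain ⟨u, hu, hub⟩ := (isPreconnected_sphere hE (0 : E) a).intermediate_value
    (a := a • p) (b := (-a) • p) (f := fun u => ‖v - u‖)
    (by simp [norm_smul, hp, abs_of_nonneg ha]) (by simp [norm_smul, hp, abs_of_nonneg ha])
    (by fun_prop) ⟨hnear, hfar⟩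
  exact ⟨u, v - u, by simpa using hu, hub, add_sub_cancel u v⟩

theorem stmt14 (r : Fin 5 → ℝ) (hr : ∀ i, 0 < r i)
    (h01 : r 0 ≤ r 1) (h34 : r 3 ≤ r 4) :
    (fun e : Fin 5 → EuclideanSpace ℝ (Fin 3) => (‖e 0 + e 1‖, ‖e 3 + e 4‖)) ''
      {e : Fin 5 → EuclideanSpace ℝ (Fin 3) | (∀ i, ‖e i‖ = r i) ∧ ∑ i, e i = 0} =
    Delta5 r := by
  have hE : 1 < Module.rank ℝ (EuclideanSpace ℝ (Fin 3)) :=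
    Module.lt_rank_of_lt_finrank (by simp)
  ext ⟨x, y⟩
  constructor
  · rintro ⟨e, ⟨he, hsum⟩, hxy⟩
    obtain ⟨rfl, rfl⟩ := Prod.mk.inj hxy
    have hmid : ‖(e 0 + e 1) + (e 3 + e 4)‖ = r 2 := by
      rw [Fin.sum_univ_five] at hsum
      rw [← he 2, ← norm_neg (e 2)]
      congr 1
      rw [eq_neg_iff_add_eq_zero, ← hsum]
      abel
    simp only [Delta5, Set.mem_ofPred_eq, ← he 0, ← he 1, ← hmid, ← he 3, ← he 4]
    have h₁ := norm_le_add_norm_add (e 0 + e 1) (e 3 + e 4)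
    have h₂ := norm_le_add_norm_add (e 3 + e 4) (e 0 + e 1)
    rw [add_comm (e 3 + e 4)] at h₂
    have h₃ := norm_add_le (e 0 + e 1) (e 3 + e 4)
    have h₄ := norm_le_add_norm_add (e 1) (e 0)
    rw [add_comm (e 1)] at h₄
    have h₅ := norm_le_add_norm_add (e 4) (e 3)
    rw [add_comm (e 4)] at h₅
    have h₆ := norm_add_le (e 0) (e 1)
    have h₇ := norm_add_le (e 3) (e 4)
    refine ⟨?_, ?_, ?_, ?_, ?_, ?_, ?_⟩ <;> linarith
  · rintro ⟨hx₁, hx₂, hy₁, hy₂, hxy₁, hxy₂, hxy₃⟩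
    dsimp only at hx₁ hx₂ hy₁ hy₂ hxy₁ hxy₂ hxy₃
    obtain ⟨A, hA⟩ := exists_norm_eq (EuclideanSpace ℝ (Fin 3)) (show 0 ≤ x by linarith)
    obtain ⟨B, C, hB, hC, hBC⟩ := exists_add_eq_of_norm_eq_of_norm_eq hE (v := -A) (a := y)
      (b := r 2) (by linarith) (by rw [norm_neg]; linarith) (by rw [norm_neg]; linarith)
      (by rw [norm_neg]; linarith)
    have h₀ := hr 0
    have h₃ := hr 3
    obtain ⟨e₀, e₁, he₀, he₁, hA'⟩ := exists_add_eq_of_norm_eq_of_norm_eq hE (v := A) (a := r 0)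
      (b := r 1) h₀.le (by linarith) (by linarith) (by linarith)
    obtain ⟨e₃, e₄, he₃, he₄, hB'⟩ := exists_add_eq_of_norm_eq_of_norm_eq hE (v := B) (a := r 3)
      (b := r 4) h₃.le (by linarith) (by linarith) (by linarith)
    refine ⟨![e₀, e₁, C, e₃, e₄], ⟨?_, ?_⟩, ?_⟩
    · intro i
      fin_cases i <;> assumption
    · calc ∑ i, ![e₀, e₁, C, e₃, e₄] i = (e₀ + e₁) + ((e₃ + e₄) + C) := by
            simp [Fin.sum_univ_five]
            abel
        _ = 0 := by rw [hA', hB', hBC, add_neg_cancel]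
    · change (‖e₀ + e₁‖, ‖e₃ + e₄‖) = (x, y)
      rw [hA', hB', hA, hB]
end

section
/- Let r = (r_1, r_2, r_3, r_4) satisfy 0 < r_1 ≤ r_2 ≤ r_3 ≤ r_4, let r be generic, and assume r_4 < r_1 + r_2 + r_3. Then the image of the map assigning to each closed 4-gon (e_1,…,e_4) with side lengths r the diagonal length ‖e_1 + e_2‖ is exactly the closed interval [max(r_2 − r_1, r_4 − r_3), r_1 + r_2], and the length of this interval equals min(2r_1, r_1 + r_2 + r_3 − r_4), which is positive. -/
/-- A triangle with side lengths `a ≤ b` and `d` satisfying the triangle inequalities exists in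
`ℝ³`, with the side of length `d` along the first coordinate axis. -/
lemma exists_add_eq_axis {a b d : ℝ} (ha : 0 ≤ a) (hab : a ≤ b) (h1 : b - a ≤ d)
    (h2 : d ≤ a + b) :
    ∃ u v : EuclideanSpace ℝ (Fin 3), ‖u‖ = a ∧ ‖v‖ = b ∧ u + v = !₂[d, 0, 0] := by
  obtain ⟨x, hx, hxa⟩ : ∃ x : ℝ, 2 * d * x = d ^ 2 + a ^ 2 - b ^ 2 ∧ x ^ 2 ≤ a ^ 2 := by
    have hd : 0 ≤ d := by linarith
    rcases hd.eq_or_lt with rfl | hd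
    · obtain rfl : a = b := by linarith
      exact ⟨0, by ring, by nlinarith⟩
    · refine ⟨(d ^ 2 + a ^ 2 - b ^ 2) / (2 * d), by field_simp, sq_le_sq' ?_ ?_⟩
      · rw [le_div_iff₀ (by positivity)]
        nlinarith [mul_nonneg (by linarith : 0 ≤ d + a - b) (by linarith : 0 ≤ d + a + b)]
      · rw [div_le_iff₀ (by positivity)]
        nlinarith [mul_nonneg (by linarith : 0 ≤ b - d + a) (by linarith : 0 ≤ b + d - a)]
  have hy : √(a ^ 2 - x ^ 2) ^ 2 = a ^ 2 - x ^ 2 := Real.sq_sqrt (by linarith)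
  refine ⟨!₂[x, √(a ^ 2 - x ^ 2), 0], !₂[d - x, -√(a ^ 2 - x ^ 2), 0], ?_, ?_, ?_⟩
  · rw [← sq_eq_sq₀ (norm_nonneg _) ha, EuclideanSpace.real_norm_sq_eq]
    simp [Fin.sum_univ_three, hy]
  · rw [← sq_eq_sq₀ (norm_nonneg _) (ha.trans hab), EuclideanSpace.real_norm_sq_eq]
    simp only [Fin.sum_univ_three, Matrix.cons_val]
    linarith
  · ext i
    fin_cases i <;> simp

theorem stmt15 (r : Fin 4 → ℝ) (h0 : 0 < r 0)
    (h01 : r 0 ≤ r 1) (h12 : r 1 ≤ r 2) (h23 : r 2 ≤ r 3)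
    (hgen : IsGeneric r) (hshort : r 3 < r 0 + r 1 + r 2) :
    ((fun e : Fin 4 → EuclideanSpace ℝ (Fin 3) => ‖e 0 + e 1‖) ''
        {e : Fin 4 → EuclideanSpace ℝ (Fin 3) | (∀ i, ‖e i‖ = r i) ∧ ∑ i, e i = 0} =
      Set.Icc (max (r 1 - r 0) (r 3 - r 2)) (r 0 + r 1)) ∧
    (r 0 + r 1) - max (r 1 - r 0) (r 3 - r 2) = min (2 * r 0) (r 0 + r 1 + r 2 - r 3) ∧
    0 < min (2 * r 0) (r 0 + r 1 + r 2 - r 3) := by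
  refine ⟨?_, ?_, lt_min (by linarith) (by linarith)⟩
  · ext d
    simp only [Set.mem_image, Set.mem_ofPred_eq, Set.mem_Icc, max_le_iff]
    constructor
    · rintro ⟨e, ⟨he, hsum⟩, rfl⟩
      rw [Fin.sum_univ_four] at hsum
      have hdiag : e 0 + e 1 = -(e 2 + e 3) := by
        rw [eq_neg_iff_add_eq_zero, ← hsum]
        abel
      have hle := norm_add_le (e 0) (e 1)
      have hge := norm_sub_le_norm_add (e 1) (e 0)
      have hge' := norm_sub_le_norm_add (e 3) (e 2)
      rw [add_comm (e 1)] at hge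
      rw [add_comm (e 3), ← norm_neg (e 2 + e 3), ← hdiag] at hge'
      simp only [he] at hle hge hge'
      exact ⟨⟨hge, hge'⟩, hle⟩
    · rintro ⟨⟨hd1, hd2⟩, hd3⟩
      obtain ⟨u, v, hu, hv, huv⟩ := exists_add_eq_axis h0.le h01 hd1 hd3
      obtain ⟨u', v', hu', hv', huv'⟩ :=
        exists_add_eq_axis (h0.le.trans (h01.trans h12)) h23 hd2 (by linarith)
      refine ⟨![u, v, -u', -v'], ⟨?_, ?_⟩, ?_⟩
      · intro i
        fin_cases i <;> simp [hu, hv, hu', hv']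
      · simp only [Fin.sum_univ_four, Matrix.cons_val]
        rw [huv, ← huv']
        abel
      · have hd : 0 ≤ d := by linarith
        simp only [Matrix.cons_val]
        rw [huv, ← sq_eq_sq₀ (norm_nonneg _) hd, EuclideanSpace.real_norm_sq_eq]
        simp [Fin.sum_univ_three]
  · rw [← min_sub_sub_left]
    congr 1 <;> ring
end
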